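/- Let K be a field and Q a finite acyclic quiver. Let M be a thin indecomposable K-representation of Q such that the underlying graph of supp(M) is either a tree or a cycle (type Ã_n), and let 𝓜 = (M₁ < M₂ < ⋯ < Mₙ = M) be an indecomposable filtration of M. Then there exists a length function l on the category of finite-dimensional K-representations of Q such that 𝓜 is a GR filtration of M with respect to l. -/

import Mathlib

open scoped Classical

namespace QR

/-- A finite quiver: finite sets of vertices and arrows with source and target maps. -/
structure FinQuiver where
  V : Type
  A : Type
  [fintypeV : Fintype V]
  [fintypeA : Fintype A]
  s : A → V
  t : A → V

attribute [instance] FinQuiver.fintypeV FinQuiver.fintypeA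

/-- One oriented step along an arrow of `Q`. -/
def FinQuiver.Step (Q : FinQuiver) (v w : Q.V) : Prop := ∃ a : Q.A, Q.s a = v ∧ Q.t a = w

/-- `Q` is acyclic: it contains no oriented cycle. -/
def FinQuiver.Acyclic (Q : FinQuiver) : Prop := ∀ v : Q.V, ¬ Relation.TransGen Q.Step v v

/-- A finite-dimensional `K`-linear representation of the quiver `Q`. -/
structure Rep (K : Type) [Field K] (Q : FinQuiver) where
  space : Q.V → Type
  [instAddCommGroup : ∀ v, AddCommGroup (space v)]
  [instModule : ∀ v, Module K (space v)]
  [instFinite : ∀ v, FiniteDimensional K (space v)]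
  map : ∀ a : Q.A, space (Q.s a) →ₗ[K] space (Q.t a)

attribute [instance] Rep.instAddCommGroup Rep.instModule Rep.instFinite

variable {K : Type} [Field K] {Q : FinQuiver}

/-- A morphism of representations: linear maps commuting with the structure maps. -/
structure Hom (N M : Rep K Q) where
  app : ∀ v, N.space v →ₗ[K] M.space v
  comm : ∀ a : Q.A, (M.map a).comp (app (Q.s a)) = (app (Q.t a)).comp (N.map a)

/-- Composition of morphisms of representations. -/
def Hom.comp {X Y Z : Rep K Q} (g : Hom Y Z) (f : Hom X Y) : Hom X Z where
  app v := (g.app v).comp (f.app v)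
  comm a := by
    ext x
    have h1 := LinearMap.congr_fun (f.comm a) x
    have h2 := LinearMap.congr_fun (g.comm a) (f.app (Q.s a) x)
    simp only [LinearMap.comp_apply] at h1 h2 ⊢
    rw [h2, h1]

/-- A representation is nonzero if some vertex space contains a nonzero vector. -/
def Rep.Nonzero (M : Rep K Q) : Prop := ∃ v, ∃ x : M.space v, x ≠ 0

/-- A representation is zero if all its vertex spaces are trivial. -/
def IsZeroRep (M : Rep K Q) : Prop := ∀ v, ∀ x : M.space v, x = 0

/-- Two representations are isomorphic iff there is a morphism between them that is
bijective at every vertex. -/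
def Iso (N M : Rep K Q) : Prop := ∃ f : Hom N M, ∀ v, Function.Bijective (f.app v)

/-- The direct sum of two representations. -/
noncomputable def dsum (N N' : Rep K Q) : Rep K Q where
  space v := N.space v × N'.space v
  map a := (N.map a).prodMap (N'.map a)

/-- A representation is indecomposable if it is nonzero and not isomorphic to the
direct sum of two nonzero representations. -/
def Indecomposable (M : Rep K Q) : Prop :=
  M.Nonzero ∧ ¬ ∃ N N' : Rep K Q, N.Nonzero ∧ N'.Nonzero ∧ Iso M (dsum N N')

/-- A representation is thin if all its vertex spaces have dimension at most one. -/
def Rep.Thin (M : Rep K Q) : Prop := ∀ v, Module.finrank K (M.space v) ≤ 1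

/-- Vertices of the support of `M`. -/
def suppV (M : Rep K Q) : Set Q.V := {v | ∃ x : M.space v, x ≠ 0}

/-- Arrows of the support of `M`. -/
def suppA (M : Rep K Q) : Set Q.A := {a | M.map a ≠ 0}

/-- Two vertices are adjacent in the underlying graph of the subquiver with arrow set
`SA` if some arrow of `SA` joins them (in either direction). -/
def AdjIn (Q : FinQuiver) (SA : Set Q.A) (v w : Q.V) : Prop :=
  ∃ a ∈ SA, (Q.s a = v ∧ Q.t a = w) ∨ (Q.s a = w ∧ Q.t a = v)

/-- The subquiver with vertex set `SV` and arrow set `SA` is connected: any two of its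
vertices are joined by a walk using its arrows. -/
def ConnectedOn (Q : FinQuiver) (SV : Set Q.V) (SA : Set Q.A) : Prop :=
  ∀ v ∈ SV, ∀ w ∈ SV, Relation.ReflTransGen (AdjIn Q SA) v w

/-- The underlying graph of the subquiver with arrow set `SA` contains a cycle:
there are pairwise distinct arrows `e 0, …, e n` in `SA` and pairwise distinct
vertices `v 0, …, v n` such that `e i` joins `v i` and `v (i+1)` (cyclically,
in either direction). -/
def HasCycle (Q : FinQuiver) (SA : Set Q.A) : Prop :=
  ∃ (n : ℕ) (e : Fin (n + 1) → Q.A) (v : Fin (n + 1) → Q.V),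
    Function.Injective e ∧ (∀ i, e i ∈ SA) ∧ Function.Injective v ∧
    ∀ i : Fin (n + 1), (Q.s (e i) = v i ∧ Q.t (e i) = v (i + 1)) ∨
      (Q.s (e i) = v (i + 1) ∧ Q.t (e i) = v i)

/-- The underlying graph of the subquiver `(SV, SA)` is a tree:
nonempty, connected and with no cycles. -/
def IsTreeOn (Q : FinQuiver) (SV : Set Q.V) (SA : Set Q.A) : Prop :=
  SV.Nonempty ∧ ConnectedOn Q SV SA ∧ ¬ HasCycle Q SA

/-- The underlying graph of the subquiver `(SV, SA)` is a cycle on `n + 1 ≥ 2` vertices. -/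
def IsCycleOn (Q : FinQuiver) (SV : Set Q.V) (SA : Set Q.A) : Prop :=
  ∃ n : ℕ, 0 < n ∧ ∃ (ev : Fin (n + 1) → Q.V) (ea : Fin (n + 1) → Q.A),
    Function.Injective ev ∧ Function.Injective ea ∧
    SV = Set.range ev ∧ SA = Set.range ea ∧
    ∀ i : Fin (n + 1), (Q.s (ea i) = ev i ∧ Q.t (ea i) = ev (i + 1)) ∨
      (Q.s (ea i) = ev (i + 1) ∧ Q.t (ea i) = ev i)

/-- The canonical representation of the subquiver `(SV, SA)`: the field `K` at the
vertices of `SV`, zero elsewhere, identity maps on the arrows of `SA` (realised as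
submodules of `K` and inclusions), zero maps elsewhere. -/
noncomputable def canonical (K : Type) [Field K] (Q : FinQuiver)
    (SV : Set Q.V) (SA : Set Q.A) : Rep K Q where
  space v := ↥(if v ∈ SV then (⊤ : Submodule K K) else ⊥)
  map a :=
    if a ∈ SA then
      (if h : (if Q.s a ∈ SV then (⊤ : Submodule K K) else ⊥) ≤
          (if Q.t a ∈ SV then (⊤ : Submodule K K) else ⊥)
        then Submodule.inclusion h else 0)
    else 0

/-- The simple representation `S(i)`. -/
noncomputable def simple (K : Type) [Field K] (Q : FinQuiver) (i : Q.V) : Rep K Q :=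
  canonical K Q {i} ∅

/-- A family of submodules of the vertex spaces of `M` is a subrepresentation if it is
closed under the structure maps. -/
def IsSubRep (M : Rep K Q) (p : ∀ v, Submodule K (M.space v)) : Prop :=
  ∀ a : Q.A, ∀ x ∈ p (Q.s a), M.map a x ∈ p (Q.t a)

/-- The representation carried by a subrepresentation of `M`. -/
noncomputable def restrictRep (M : Rep K Q) (p : ∀ v, Submodule K (M.space v)) : Rep K Q where
  space v := ↥(p v)
  map a :=
    if h : ∀ x ∈ p (Q.s a), M.map a x ∈ p (Q.t a) then (M.map a).restrict h else 0

/-- The quotient representation `M / p`. -/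
noncomputable def quotRep (M : Rep K Q) (p : ∀ v, Submodule K (M.space v)) : Rep K Q where
  space v := M.space v ⧸ p v
  map a :=
    if h : p (Q.s a) ≤ (p (Q.t a)).comap (M.map a) then
      Submodule.mapQ (p (Q.s a)) (p (Q.t a)) (M.map a) h
    else 0

/-- A length function on the category of finite-dimensional `K`-representations of `Q`:
nonnegative real valued, zero exactly on the zero representations, and additive on
short exact sequences. -/
def LengthFunction (l : Rep K Q → ℝ) : Prop :=
  (∀ X, 0 ≤ l X) ∧ (∀ X, l X = 0 ↔ IsZeroRep X) ∧
    ∀ (X Y Z : Rep K Q) (f : Hom X Y) (g : Hom Y Z),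
      (∀ v, Function.Injective (f.app v)) →
      (∀ v, Function.Surjective (g.app v)) →
      (∀ v, LinearMap.range (f.app v) = LinearMap.ker (g.app v)) →
      l Y = l X + l Z


/-- The lexicographic order on finite chains (= finite subsets) of `ℝ`:
`X ≤ₗ Y` iff `min (Y \ X) ≤ min (X \ Y)`, with the convention `min ∅ = ∞`. -/
def RLexLE (X Y : Finset ℝ) : Prop := (Y \ X).min ≤ (X \ Y).min

/-- `p` is an indecomposable subrepresentation of `M`. -/
def IndecSub (M : Rep K Q) (p : ∀ v, Submodule K (M.space v)) : Prop :=
  IsSubRep M p ∧ Indecomposable (restrictRep M p)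

/-- `C` is a finite chain of indecomposable subrepresentations of `M`. -/
def IndecChain (M : Rep K Q) (C : Finset (∀ v, Submodule K (M.space v))) : Prop :=
  (∀ p ∈ C, IndecSub M p) ∧ ∀ p ∈ C, ∀ q ∈ C, p ≤ q ∨ q ≤ p

/-- The values of the length function `l` on the members of a chain of
subrepresentations of `M`. -/
noncomputable def chainL (l : Rep K Q → ℝ) (M : Rep K Q)
    (C : Finset (∀ v, Submodule K (M.space v))) : Finset ℝ :=
  C.image fun p => l (restrictRep M p)

/-- An indecomposable filtration of `M`: a chain of indecomposable subrepresentations,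
starting at a minimal (i.e. simple) one, each a direct predecessor of the next in the
poset of indecomposable subrepresentations, and ending at `M` itself. -/
def IndecFiltration (M : Rep K Q) {m : ℕ}
    (𝒩 : Fin (m + 1) → ∀ v, Submodule K (M.space v)) : Prop :=
  (∀ i, IndecSub M (𝒩 i)) ∧
  (∀ r, IndecSub M r → r ≤ 𝒩 0 → r = 𝒩 0) ∧
  (∀ i : Fin m, 𝒩 i.castSucc ≤ 𝒩 i.succ ∧ 𝒩 i.castSucc ≠ 𝒩 i.succ ∧
    ∀ r, IndecSub M r → 𝒩 i.castSucc ≤ r → r ≤ 𝒩 i.succ →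
      r = 𝒩 i.castSucc ∨ r = 𝒩 i.succ) ∧
  𝒩 (Fin.last m) = fun _ => ⊤

/-- `Z` is the Gabriel-Roiter measure `μ_l(M)`: the lexicographically greatest element of
the set of `l`-values of finite chains of indecomposable subrepresentations of `M`
with maximum `M`. -/
def IsGRMeasure (l : Rep K Q → ℝ) (M : Rep K Q) (Z : Finset ℝ) : Prop :=
  (∃ C, IndecChain M C ∧ (fun _ => (⊤ : Submodule K _)) ∈ C ∧ chainL l M C = Z) ∧
  ∀ C, IndecChain M C → (fun _ => (⊤ : Submodule K _)) ∈ C → RLexLE (chainL l M C) Z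

/-- `𝒩` is a GR filtration of `M` with respect to `l`: an indecomposable filtration
whose chain of `l`-values attains the Gabriel-Roiter measure of `M`. -/
def IsGRFiltration (l : Rep K Q → ℝ) (M : Rep K Q) {m : ℕ}
    (𝒩 : Fin (m + 1) → ∀ v, Submodule K (M.space v)) : Prop :=
  IndecFiltration M 𝒩 ∧
    ∀ C, IndecChain M C → (fun _ => (⊤ : Submodule K _)) ∈ C →
      RLexLE (chainL l M C) (chainL l M (Finset.image 𝒩 Finset.univ))

/-- `(SV, SA)` is a subquiver of `Q`: arrows of `SA` have their endpoints in `SV`. -/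
def IsSubquiver (Q : FinQuiver) (P : Set Q.V × Set Q.A) : Prop :=
  ∀ a ∈ P.2, Q.s a ∈ P.1 ∧ Q.t a ∈ P.1

/-- `P` is a member of `ℒ(Q)`, the poset of connected nonempty subquivers of `Q`. -/
def InL (Q : FinQuiver) (P : Set Q.V × Set Q.A) : Prop :=
  IsSubquiver Q P ∧ P.1.Nonempty ∧ ConnectedOn Q P.1 P.2

/-- The order `≤_C` on subquivers: `P` is a subquiver of `P'` and every arrow of `P'`
whose source lies in `P` also has its target in `P`. -/
def leC (Q : FinQuiver) (P P' : Set Q.V × Set Q.A) : Prop :=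
  P.1 ⊆ P'.1 ∧ P.2 ⊆ P'.2 ∧ ∀ a ∈ P'.2, Q.s a ∈ P.1 → Q.t a ∈ P.1

/-- The total weight of the vertices of a subquiver. -/
noncomputable def qweight (w : Q.V → ℝ) (P : Set Q.V × Set Q.A) : ℝ :=
  ∑ v : Q.V, if v ∈ P.1 then w v else 0

/-- `C` is a finite chain in the poset `ℒ(Q)`. -/
def LChain (Q : FinQuiver) (C : Finset (Set Q.V × Set Q.A)) : Prop :=
  (∀ P ∈ C, InL Q P) ∧ ∀ P ∈ C, ∀ P' ∈ C, leC Q P P' ∨ leC Q P' P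

/-- The weights of the members of a chain of subquivers. -/
noncomputable def qchainW (w : Q.V → ℝ) (C : Finset (Set Q.V × Set Q.A)) : Finset ℝ :=
  C.image (qweight w)

/-- A filtration in the poset `ℒ(Q)`: starting at a minimal connected subquiver, each
member a direct predecessor of the next one. -/
def LFiltration (Q : FinQuiver) {m : ℕ} (𝒬 : Fin (m + 1) → Set Q.V × Set Q.A) : Prop :=
  (∀ i, InL Q (𝒬 i)) ∧
  (∀ P, InL Q P → leC Q P (𝒬 0) → P = 𝒬 0) ∧
  ∀ i : Fin m, leC Q (𝒬 i.castSucc) (𝒬 i.succ) ∧ 𝒬 i.castSucc ≠ 𝒬 i.succ ∧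
    ∀ P, InL Q P → leC Q (𝒬 i.castSucc) P → leC Q P (𝒬 i.succ) →
      P = 𝒬 i.castSucc ∨ P = 𝒬 i.succ

/-- `Z` is the value `w*(P₀)` of the induced chain length function of the weight
function `w` in the poset `ℒ(Q)`. -/
def IsWStar (Q : FinQuiver) (w : Q.V → ℝ) (P₀ : Set Q.V × Set Q.A) (Z : Finset ℝ) : Prop :=
  (∃ C, LChain Q C ∧ (P₀ ∈ C ∧ ∀ P ∈ C, leC Q P P₀) ∧ qchainW w C = Z) ∧
  ∀ C, LChain Q C → (P₀ ∈ C ∧ ∀ P ∈ C, leC Q P P₀) → RLexLE (qchainW w C) Z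

/-- `𝒬` is a `w*`-filtration of `P₀` in the poset `ℒ(Q)`. -/
def IsWStarLFiltration (Q : FinQuiver) (w : Q.V → ℝ) {m : ℕ}
    (𝒬 : Fin (m + 1) → Set Q.V × Set Q.A) (P₀ : Set Q.V × Set Q.A) : Prop :=
  LFiltration Q 𝒬 ∧ 𝒬 (Fin.last m) = P₀ ∧
    ∀ C, LChain Q C → (P₀ ∈ C ∧ ∀ P ∈ C, leC Q P P₀) →
      RLexLE (qchainW w C) (qchainW w (Finset.image 𝒬 Finset.univ))

/-- `E` is an injective object in the category of finite-dimensional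
`K`-representations of `Q`. -/
def InjectiveRep (E : Rep K Q) : Prop :=
  ∀ (X Y : Rep K Q) (f : Hom X Y), (∀ v, Function.Injective (f.app v)) →
    ∀ g : Hom X E, ∃ h : Hom Y E, Hom.comp h f = g

end QR

namespace QR

/-- A strictly monotone valuation `f` with `f T ≤ f (S j) → T ≤ S j` makes the saturated chain
`S` lexicographically greatest among the finite chains with the same maximum. -/
theorem rlexLE_image_of_saturated {α : Type*} [PartialOrder α] [DecidableEq α] {f : α → ℝ} (hf : StrictMono f)
    {I : α → Prop} {m : ℕ} {S : Fin (m + 1) → α}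
    (hle : ∀ j T, f T ≤ f (S j) → T ≤ S j)
    (hzero : ∀ T, I T → T ≤ S 0 → T = S 0)
    (hsucc : ∀ i : Fin m, ∀ T, I T → S i.castSucc ≤ T → T ≤ S i.succ →
      T = S i.castSucc ∨ T = S i.succ)
    {C : Finset α} (hCI : ∀ T ∈ C, I T) (hC : ∀ T ∈ C, ∀ T' ∈ C, T ≤ T' ∨ T' ≤ T)
    (hlast : ∀ T ∈ C, T ≤ S (Fin.last m)) :
    RLexLE (C.image f) ((Finset.image S Finset.univ).image f) := by
  refine Finset.le_min fun x hx => ?_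
  obtain ⟨hxC, hxS⟩ := Finset.mem_sdiff.1 hx
  obtain ⟨T, hT, rfl⟩ := Finset.mem_image.1 hxC
  have hne : ∀ j, T ≠ S j := by
    rintro j rfl
    exact hxS (Finset.mem_image_of_mem f (Finset.mem_image_of_mem S (Finset.mem_univ j)))
  suffices h : ∀ j, f T ≤ f (S j) →
      ∃ y ∈ (Finset.image S Finset.univ).image f \ C.image f, y ≤ f T by
    obtain ⟨y, hy, hyx⟩ := h (Fin.last m) (hf.monotone (hlast T hT))
    exact (Finset.min_le hy).trans (WithTop.coe_le_coe.2 hyx)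
  intro j
  induction j using Fin.induction with
  | zero => exact fun h => absurd (hzero T (hCI T hT) (hle 0 T h)) (hne 0)
  | succ i ih =>
    intro h
    rcases le_or_gt (f T) (f (S i.castSucc)) with hlt | hgt
    · exact ih hlt
    refine ⟨f (S i.castSucc), Finset.mem_sdiff.2
      ⟨Finset.mem_image_of_mem f (Finset.mem_image_of_mem S (Finset.mem_univ _)), ?_⟩, hgt.le⟩
    intro hmem
    obtain ⟨T', hT', hTS⟩ := Finset.mem_image.1 hmem
    obtain rfl : T' = S i.castSucc := by
      refine (hle _ _ hTS.le).eq_of_not_lt fun hlt => ?_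
      exact (hf hlt).ne hTS
    rcases hC T hT _ hT' with hle' | hge
    · exact absurd (hf.monotone hle') hgt.not_ge
    · rcases hsucc i T (hCI T hT) hge (hle _ T h) with h | h
      · exact hne _ h
      · exact hne _ h

variable {K : Type} [Field K] {Q : FinQuiver}

/-- The length of a representation with respect to weights on the vertices. -/
noncomputable def weightedLength (w : Q.V → ℝ) (X : Rep K Q) : ℝ :=
  ∑ v, w v * Module.finrank K (X.space v)

theorem lengthFunction_weightedLength {w : Q.V → ℝ} (hw : ∀ v, 0 < w v) :
    LengthFunction (weightedLength (K := K) w) := by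
  have hterm (X : Rep K Q) (v : Q.V) : 0 ≤ w v * (Module.finrank K (X.space v) : ℝ) :=
    mul_nonneg (hw v).le (Nat.cast_nonneg _)
  refine ⟨fun X => Finset.sum_nonneg fun v _ => hterm X v, fun X => ?_, ?_⟩
  · rw [weightedLength, Finset.sum_eq_zero_iff_of_nonneg fun v _ => hterm X v]
    simp only [Finset.mem_univ, true_imp_iff, mul_eq_zero, (hw _).ne', false_or, Nat.cast_eq_zero,
      Module.finrank_zero_iff, IsZeroRep]
    exact forall_congr' fun v => subsingleton_iff_forall_eq 0
  · intro X Y Z f g hf hg hfg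
    simp only [weightedLength, ← Finset.sum_add_distrib, ← mul_add]
    refine Finset.sum_congr rfl fun v _ => ?_
    have h := LinearMap.finrank_range_add_finrank_ker (g.app v)
    rw [← hfg v, LinearMap.finrank_range_of_inj (hf v), LinearMap.range_eq_top.2 (hg v),
      finrank_top] at h
    rw [← h, add_comm]
    push_cast
    rfl

theorem strictMono_weightedLength_restrictRep {w : Q.V → ℝ} (hw : ∀ v, 0 < w v) (M : Rep K Q) :
    StrictMono fun p : ∀ v, Submodule K (M.space v) => weightedLength w (restrictRep M p) := by
  intro p q hpq
  obtain ⟨hle, v, hv⟩ := Pi.lt_def.1 hpq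
  refine Finset.sum_lt_sum (fun u _ => ?_) ⟨v, Finset.mem_univ v, ?_⟩
  · exact mul_le_mul_of_nonneg_left (Nat.cast_le.2 (Submodule.finrank_mono (hle u))) (hw u).le
  · exact mul_lt_mul_of_pos_left (Nat.cast_lt.2 (Submodule.finrank_lt_finrank_of_lt hv)) (hw v)

/-- The number of members of a family of subspaces that vanish at the vertex `v`. -/
noncomputable def vanishCount {M : Rep K Q} {m : ℕ}
    (S : Fin (m + 1) → ∀ v, Submodule K (M.space v)) (v : Q.V) : ℕ :=
  (Finset.univ.filter fun k => S k v = ⊥).card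

theorem vanishCount_lt {M : Rep K Q} {m : ℕ} {S : Fin (m + 1) → ∀ v, Submodule K (M.space v)}
    (hS : Monotone S) {j : Fin (m + 1)} {u v : Q.V} (hu : S j u ≠ ⊥) (hv : S j v = ⊥) :
    vanishCount S u < vanishCount S v := by
  refine Finset.card_lt_card ⟨fun k hk => ?_, fun hsub => hu ?_⟩
  · simp only [Finset.mem_filter, Finset.mem_univ, true_and] at hk ⊢
    rcases le_total k j with hkj | hjk
    · exact le_bot_iff.1 (hv ▸ hS hkj v)
    · exact absurd (le_bot_iff.1 (hk ▸ hS hjk u)) hu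
  · simpa using hsub (by simpa using hv : j ∈ Finset.univ.filter fun k => S k v = ⊥)

/-- Weights that grow rapidly along the family `S`. -/
noncomputable def vanishWeight {M : Rep K Q} {m : ℕ}
    (S : Fin (m + 1) → ∀ v, Submodule K (M.space v)) (v : Q.V) : ℝ :=
  ((Fintype.card Q.V : ℝ) + 1) ^ vanishCount S v

theorem vanishWeight_pos {M : Rep K Q} {m : ℕ} (S : Fin (m + 1) → ∀ v, Submodule K (M.space v))
    (v : Q.V) : 0 < vanishWeight S v := by
  unfold vanishWeight
  positivity

/-- If `S j` vanishes at `v`, the weight of `v` exceeds the total weight of `S j`. -/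
theorem weightedLength_lt_vanishWeight {M : Rep K Q} (hM : M.Thin) {m : ℕ}
    {S : Fin (m + 1) → ∀ v, Submodule K (M.space v)} (hS : Monotone S) {j : Fin (m + 1)} {v : Q.V}
    (hv : S j v = ⊥) :
    weightedLength (vanishWeight S) (restrictRep M (S j)) < vanishWeight S v := by
  set B : ℝ := (Fintype.card Q.V : ℝ) + 1 with hB
  have hBpos : 0 < B := by positivity
  have hB1 : 1 ≤ B := by simp [hB]
  have hterm (u : Q.V) :
      B * (vanishWeight S u * (Module.finrank K (S j u) : ℝ)) ≤ vanishWeight S v := by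
    by_cases hu : S j u = ⊥
    · rw [hu, finrank_bot]
      simpa using (vanishWeight_pos S v).le
    · have hone : (Module.finrank K (S j u) : ℝ) ≤ 1 := by
        exact_mod_cast (Submodule.finrank_le _).trans (hM u)
      calc B * (vanishWeight S u * (Module.finrank K (S j u) : ℝ))
          ≤ B * (vanishWeight S u * 1) := by
            gcongr
            exact (vanishWeight_pos S u).le
        _ = B ^ (vanishCount S u + 1) := by rw [mul_one, pow_succ', vanishWeight]
        _ ≤ B ^ vanishCount S v := pow_le_pow_right₀ hB1 (vanishCount_lt hS hu hv)
  have hsum : B * weightedLength (vanishWeight S) (restrictRep M (S j)) ≤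
      Fintype.card Q.V * vanishWeight S v := by
    rw [weightedLength, Finset.mul_sum, ← nsmul_eq_mul]
    exact Finset.sum_le_card_nsmul _ _ _ fun u _ => hterm u
  refine lt_of_mul_lt_mul_left (hsum.trans_lt ?_) hBpos.le
  exact mul_lt_mul_of_pos_right (by simp [hB]) (vanishWeight_pos S v)

theorem le_of_weightedLength_le {M : Rep K Q} (hM : M.Thin) {m : ℕ}
    {S : Fin (m + 1) → ∀ v, Submodule K (M.space v)} (hS : Monotone S) (j : Fin (m + 1))
    (T : ∀ v, Submodule K (M.space v))
    (h : weightedLength (vanishWeight S) (restrictRep M T) ≤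
      weightedLength (vanishWeight S) (restrictRep M (S j))) : T ≤ S j := by
  by_contra hTS
  obtain ⟨v, hv⟩ := not_forall.1 hTS
  have hSv : S j v = ⊥ := by
    have hne : S j v ≠ ⊤ := fun htop => hv (by rw [htop]; exact le_top)
    have hlt := Submodule.finrank_lt hne
    exact Submodule.finrank_eq_zero.1 (by have := hM v; omega)
  have hTv : 1 ≤ Module.finrank K (T v) := by
    refine Nat.one_le_iff_ne_zero.2 fun h0 => hv ?_
    rw [Submodule.finrank_eq_zero.1 h0]
    exact bot_le
  have hge : vanishWeight S v ≤ weightedLength (vanishWeight S) (restrictRep M T) :=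
    calc vanishWeight S v ≤ vanishWeight S v * (Module.finrank K (T v) : ℝ) :=
          le_mul_of_one_le_right (vanishWeight_pos S v).le (by exact_mod_cast hTv)
      _ ≤ _ := Finset.single_le_sum
          (f := fun u => vanishWeight S u * (Module.finrank K (T u) : ℝ))
          (fun u _ => mul_nonneg (vanishWeight_pos S u).le (Nat.cast_nonneg _))
          (Finset.mem_univ v)
  exact (hge.trans h).not_gt (weightedLength_lt_vanishWeight hM hS hSv)

end QR

open QR in
theorem stmt12 (K : Type) [Field K] (Q : FinQuiver) (hQ : Q.Acyclic)
    (M : Rep K Q) (hthin : M.Thin) (hind : Indecomposable M)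
    (hsupp : IsTreeOn Q (suppV M) (suppA M) ∨ IsCycleOn Q (suppV M) (suppA M))
    (m : ℕ) (𝓜 : Fin (m + 1) → ∀ v, Submodule K (M.space v))
    (hfil : IndecFiltration M 𝓜) :
    ∃ l : Rep K Q → ℝ, LengthFunction l ∧ IsGRFiltration l M 𝓜 := by
  obtain ⟨-, hzero, hsucc, hlast⟩ := id hfil
  have hmono : Monotone 𝓜 := Fin.monotone_iff_le_succ.2 fun i => (hsucc i).1
  refine ⟨weightedLength (vanishWeight 𝓜), lengthFunction_weightedLength (vanishWeight_pos 𝓜),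
    hfil, fun C hC _ => ?_⟩
  refine rlexLE_image_of_saturated (I := IndecSub M)
    (strictMono_weightedLength_restrictRep (vanishWeight_pos 𝓜) M)
    (le_of_weightedLength_le hthin hmono) hzero (fun i => (hsucc i).2.2) hC.1 hC.2
    fun T _ => ?_
  rw [hlast]
  exact fun v => le_top
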